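/- arXiv:2009.10988 — 2 statements merged into one kernel-verified Lean document; each statement's English description precedes it below -/
import Mathlib

section
/- Let T be a stable tree of the tree connection game with n agents and let x be any node of T. Consider the subgame consisting of the tree connection game whose agents are exactly the agents corresponding to the nodes of the subtree T(x) other than x, with x playing the role of the root. Then the restriction of the strategy profile to these agents is a Nash equilibrium of this subgame; i.e., the subtree T(x) is stable in the corresponding subgame. -/
open Function
open scoped ENNReal Classical

noncomputable section

namespace TCG

variable {n : ℕ}

/-- In-degree of node `v` in the network induced by profile `s` with root `r`:
the number of activated edges `(u, v)` with `u` an agent (a non-root node). -/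
def indeg (r : Fin (n + 1)) (s : Fin (n + 1) → Fin (n + 1)) (v : Fin (n + 1)) : ℕ :=
  Nat.card {u : Fin (n + 1) | u ≠ r ∧ s u = v}

/-- `|T(u)|`: the number of nodes having a directed path to `u` (including `u` itself). -/
def subtreeSize (s : Fin (n + 1) → Fin (n + 1)) (u : Fin (n + 1)) : ℕ :=
  Nat.card {w : Fin (n + 1) | ∃ k, s^[k] w = u}

/-- Cost of the agent at node `v` with respect to the root `r`:
the sum, over the edges `(u, u')` of the unique directed path from `v` to `r`,
of `indeg(u') / |T(u)|`; the cost is `∞` if no such path exists. -/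
def cost (r : Fin (n + 1)) (s : Fin (n + 1) → Fin (n + 1)) (v : Fin (n + 1)) : ℝ≥0∞ :=
  if h : ∃ k, s^[k] v = r then
    ∑ k ∈ Finset.range (Nat.find h),
      (indeg r s (s^[k + 1] v) : ℝ≥0∞) / (subtreeSize s (s^[k] v) : ℝ≥0∞)
  else ⊤

/-- A valid strategy profile: the root is absorbing (a formal convention encoding that the
root activates no edge), and every agent chooses a node different from herself. -/
def ValidProfile (r : Fin (n + 1)) (s : Fin (n + 1) → Fin (n + 1)) : Prop :=
  s r = r ∧ ∀ v, v ≠ r → s v ≠ v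

/-- Pure Nash equilibrium (the induced network is *stable*): no agent can strictly
decrease her cost by unilaterally switching her activated edge to another node. -/
def IsStable (r : Fin (n + 1)) (s : Fin (n + 1) → Fin (n + 1)) : Prop :=
  ValidProfile r s ∧
    ∀ v, v ≠ r → ∀ w, w ≠ v → cost r s v ≤ cost r (Function.update s v w) v

/-- Social cost: the sum of the costs of all agents (the non-root nodes). -/
def SC (s : Fin (n + 1) → Fin (n + 1)) : ℝ≥0∞ :=
  ∑ v ∈ Finset.univ.erase (0 : Fin (n + 1)), cost 0 s v

/-- Height of the induced network: the maximum length of a (leaf-to-)root path,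
i.e. the least `k` such that every node arrives at the root after `k` steps. -/
def height (s : Fin (n + 1) → Fin (n + 1)) : ℕ :=
  sInf {k | ∀ v, s^[k] v = 0}

/-- Fairness Ratio: maximum agent cost divided by minimum agent cost. -/
def FR (s : Fin (n + 1) → Fin (n + 1)) : ℝ≥0∞ :=
  (⨆ (v : Fin (n + 1)) (_ : v ≠ 0), cost 0 s v) /
    (⨅ (v : Fin (n + 1)) (_ : v ≠ 0), cost 0 s v)

theorem eq_root_of_cycle {r x : Fin (n + 1)} {s : Fin (n + 1) → Fin (n + 1)} (hr : s r = r)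
    (hx : ∃ k, s^[k] x = r) {k : ℕ} (hk : s^[k + 1] x = x) : x = r := by
  obtain ⟨m, hm⟩ := hx
  have h : s^[m * k + m] x = x := by
    have := iterate_fixed hk m
    rwa [← iterate_mul, show (k + 1) * m = m * k + m by ring] at this
  rw [iterate_add_apply, hm, iterate_fixed hr] at h
  exact h.symm

/-- The nodes above a non-root node `x` do not lie in `T(x)`. -/
theorem not_reaches_of_above {r x : Fin (n + 1)} {s : Fin (n + 1) → Fin (n + 1)} (hr : s r = r)
    (hx : ∃ k, s^[k] x = r) (hxr : x ≠ r) (k m : ℕ) : s^[m] (s^[k + 1] x) ≠ x := by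
  intro h
  rw [← iterate_add_apply, ← add_assoc] at h
  exact hxr (eq_root_of_cycle hr hx h)

theorem subtreeSize_ne_zero (s : Fin (n + 1) → Fin (n + 1)) (u : Fin (n + 1)) :
    subtreeSize s u ≠ 0 := by
  have : Nonempty {w : Fin (n + 1) | ∃ k, s^[k] w = u} := ⟨⟨u, 0, rfl⟩⟩
  exact Nat.card_pos.ne'

theorem cost_ne_top {r v : Fin (n + 1)} {s : Fin (n + 1) → Fin (n + 1)}
    (h : ∃ k, s^[k] v = r) : cost r s v ≠ ⊤ := by
  rw [cost, dif_pos h]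
  refine ENNReal.sum_ne_top.2 fun k _ => ENNReal.div_ne_top (ENNReal.natCast_ne_top _) ?_
  exact_mod_cast subtreeSize_ne_zero s _

/-- Inside `T(x)`, in-degrees in the subgame with root `x` agree with those in the game. -/
theorem indeg_subgame {r x y : Fin (n + 1)} {s : Fin (n + 1) → Fin (n + 1)} (hr : s r = r)
    (hx : ∃ k, s^[k] x = r) (hxr : x ≠ r) (hy : ∃ m, s^[m] y = x) :
    indeg x s y = indeg r s y := by
  obtain ⟨m, hm⟩ := hy
  unfold indeg
  congr! 4 with u
  constructor
  · rintro ⟨-, hu⟩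
    refine ⟨?_, hu⟩
    rintro rfl
    rw [← hu, hr, iterate_fixed hr] at hm
    exact hxr hm.symm
  · rintro ⟨-, hu⟩
    refine ⟨?_, hu⟩
    rintro rfl
    rw [← hu] at hm
    exact not_reaches_of_above hr hx hxr 0 m hm

/-- The cost of an agent in `T(x)` is her cost in the subgame with root `x` plus the cost
of `x`. -/
theorem cost_eq_subgame_add {r x v : Fin (n + 1)} {s : Fin (n + 1) → Fin (n + 1)}
    (hr : s r = r) (hx : ∃ k, s^[k] x = r) (hxr : x ≠ r) (hv : ∃ k, s^[k] v = x) :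
    cost r s v = cost x s v + cost r s x := by
  have hfind : s^[Nat.find hv] v = x := Nat.find_spec hv
  have hiter : ∀ k, s^[Nat.find hv + k] v = s^[k] x := fun k => by
    rw [add_comm (Nat.find hv), iterate_add_apply, hfind]
  have hvr : ∃ k, s^[k] v = r := ⟨Nat.find hv + Nat.find hx, by rw [hiter, Nat.find_spec hx]⟩
  have hlen : Nat.find hvr = Nat.find hv + Nat.find hx := by
    rw [Nat.find_eq_iff]
    refine ⟨by rw [hiter, Nat.find_spec hx], fun m hm h => ?_⟩
    rcases le_or_gt (Nat.find hv) m with hle | hlt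
    · obtain ⟨k, rfl⟩ := Nat.exists_eq_add_of_le hle
      rw [hiter] at h
      exact Nat.find_min hx (by omega) h
    · obtain ⟨k, hk⟩ := Nat.exists_eq_add_of_le hlt.le
      rw [hk, add_comm m, iterate_add_apply, h, iterate_fixed hr] at hfind
      exact hxr hfind.symm
  rw [cost, cost, cost, dif_pos hvr, dif_pos hv, dif_pos hx, hlen, Finset.sum_range_add]
  congr 1
  · refine Finset.sum_congr rfl fun k hk => ?_
    rw [indeg_subgame hr hx hxr]
    obtain ⟨m, hm⟩ := Nat.exists_eq_add_of_le (Nat.add_one_le_iff.2 (Finset.mem_range.1 hk))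
    exact ⟨m, by rw [← iterate_add_apply, add_comm m, ← hm, hfind]⟩
  · refine Finset.sum_congr rfl fun k _ => ?_
    rw [add_assoc, hiter, hiter]

/-- Two profiles differing only at `v`, with `v` in the subtree of `x` for the second one,
where `x` has the same orbit in both: every node below some `s^[k] x` remains so. -/
theorem reaches_of_eq_off {v x : Fin (n + 1)} {s t : Fin (n + 1) → Fin (n + 1)}
    (hst : ∀ u, u ≠ v → t u = s u) (hv : ∃ m, t^[m] v = x) {k : ℕ} (horb : t^[k] x = s^[k] x)
    (m : ℕ) (u : Fin (n + 1)) (hu : s^[m] u = s^[k] x) : ∃ m', t^[m'] u = s^[k] x := by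
  induction m generalizing u with
  | zero => exact ⟨0, hu⟩
  | succ m ih =>
    by_cases huv : u = v
    · obtain ⟨l, hl⟩ := hv
      exact ⟨k + l, by rw [huv, iterate_add_apply, hl, horb]⟩
    · obtain ⟨m', hm'⟩ := ih (s u) hu
      exact ⟨m' + 1, by rw [iterate_succ_apply, hst u huv, hm']⟩

/-- A change of strategy inside `T(x)` does not affect the cost of `x`. -/
theorem cost_eq_of_eq_off {r v x : Fin (n + 1)} {s t : Fin (n + 1) → Fin (n + 1)}
    (hst : ∀ u, u ≠ v → t u = s u) (hvx : v ≠ x) (hs : s r = r) (ht : t r = r)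
    (hx : ∃ k, s^[k] x = r) (hxr : x ≠ r) (hvs : ∃ m, s^[m] v = x) (hvt : ∃ m, t^[m] v = x)
    (horb : ∀ k, t^[k] x = s^[k] x) : cost r t x = cost r s x := by
  have hxt : ∃ k, t^[k] x = r := by simpa only [horb] using hx
  have key : ∀ {q : Fin (n + 1) → Fin (n + 1)}, q r = r → (∃ k, q^[k] x = r) →
      (∃ m, q^[m] v = x) → ∀ k, q v ≠ q^[k + 1] x := by
    rintro q hq hxq ⟨m, hm⟩ k h
    cases m with
    | zero => exact hvx hm
    | succ m =>
      rw [iterate_succ_apply, h] at hm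
      exact not_reaches_of_above hq hxq hxr k m hm
  have hsize : ∀ k, subtreeSize t (s^[k] x) = subtreeSize s (s^[k] x) := fun k => by
    unfold subtreeSize
    congr! 4 with u
    constructor
    · rintro ⟨m, hm⟩
      rw [← horb] at hm ⊢
      exact reaches_of_eq_off (fun u hu => (hst u hu).symm) hvs (horb k).symm m u hm
    · rintro ⟨m, hm⟩
      exact reaches_of_eq_off hst hvt (horb k) m u hm
  have hindeg : ∀ k, indeg r t (s^[k + 1] x) = indeg r s (s^[k + 1] x) := fun k => by
    unfold indeg
    congr! 5 with u
    by_cases huv : u = v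
    · subst huv
      exact iff_of_false (horb (k + 1) ▸ key ht hxt hvt k) (key hs hx hvs k)
    · rw [hst u huv]
  simp only [cost, horb, hsize, hindeg]

/-- If `T` is a stable tree, then any subtree `T(x)` is stable in the
corresponding subgame: no agent `v` in `T(x)` other than `x` can strictly decrease her
cost towards the subgame root `x` by switching her edge to another node `w` of `T(x)`. -/
theorem subtree_of_stable_is_stable {n : ℕ} (s : Fin (n + 1) → Fin (n + 1))
    (hstable : IsStable 0 s) (htree : ∀ v, ∃ k, s^[k] v = 0)
    (x : Fin (n + 1)) :
    ∀ v : Fin (n + 1), (∃ k, s^[k] v = x) → v ≠ x →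
      ∀ w : Fin (n + 1), (∃ k, s^[k] w = x) → w ≠ v →
        cost x s v ≤ cost x (Function.update s v w) v := by
  intro v hv hvx w _ hwv
  obtain ⟨⟨hroot, -⟩, hnash⟩ := hstable
  have hv0 : v ≠ 0 := by
    rintro rfl
    obtain ⟨k, hk⟩ := hv
    exact hvx (by rwa [iterate_fixed hroot] at hk)
  by_cases hx0 : x = 0
  · subst hx0
    exact hnash v hv0 w hwv
  by_cases hvt : ∃ k, (Function.update s v w)^[k] v = x
  · set t := Function.update s v w with ht_def
    have hst : ∀ u, u ≠ v → t u = s u := fun u hu => Function.update_of_ne hu _ _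
    have ht : t 0 = 0 := by rw [hst 0 hv0.symm, hroot]
    have hav : ∀ k, s^[k] x ≠ v := by
      rintro (_ | k) h
      · exact hvx h.symm
      · obtain ⟨m, hm⟩ := hv
        rw [← h] at hm
        exact not_reaches_of_above hroot (htree x) hx0 k m hm
    have horb : ∀ k, t^[k] x = s^[k] x := by
      intro k
      induction k with
      | zero => rfl
      | succ k ih => rw [iterate_succ_apply', iterate_succ_apply', ih, hst _ (hav k)]
    have hxt : ∃ k, t^[k] x = 0 := by simpa only [horb] using htree x
    have h := hnash v hv0 w hwv
    rw [← ht_def, cost_eq_subgame_add hroot (htree x) hx0 hv,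
      cost_eq_subgame_add ht hxt hx0 hvt,
      cost_eq_of_eq_off hst hvx hroot ht (htree x) hx0 hv hvt horb] at h
    exact (ENNReal.add_le_add_iff_right (cost_ne_top (htree x))).1 h
  · rw [cost, cost, dif_neg hvt]
    exact le_top

end TCG
end
end

section
/- In any stable tree T of the tree connection game, the parent of any leaf has in-degree exactly 1; i.e., if v is a node with indeg(v) = 0 and (v, u) is the edge activated by the agent at v, then indeg(u) = 1. -/
open Function
open scoped ENNReal Classical

noncomputable section

namespace TCG

variable {n : ℕ}

theorem cost_root (r : Fin (n + 1)) (s : Fin (n + 1) → Fin (n + 1)) : cost r s r = 0 := by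
  have h : ∃ k, s^[k] r = r := ⟨0, rfl⟩
  rw [cost, dif_pos h, (Nat.find_eq_zero h).2 rfl, Finset.sum_range_zero]

theorem cost_eq_add_cost {r v : Fin (n + 1)} (s : Fin (n + 1) → Fin (n + 1)) (hv : v ≠ r) :
    cost r s v = (indeg r s (s v) : ℝ≥0∞) / (subtreeSize s v : ℝ≥0∞) + cost r s (s v) := by
  by_cases h : ∃ k, s^[k] (s v) = r
  · have h' : ∃ k, s^[k] v = r := h.imp' Nat.succ fun _ hk => hk
    rw [cost, dif_pos h', cost, dif_pos h, Nat.find_comp_succ h' h hv, Finset.sum_range_succ',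
      add_comm]
    rfl
  · have h' : ¬∃ k, s^[k] v = r := by
      rintro ⟨_ | k, hk⟩
      · exact hv hk
      · exact h ⟨k, hk⟩
    rw [cost, dif_neg h', cost, dif_neg h, add_top]

theorem subtreeSize_pos (s : Fin (n + 1) → Fin (n + 1)) (u : Fin (n + 1)) :
    0 < subtreeSize s u :=
  Nat.card_pos_iff.2 ⟨⟨⟨u, 0, rfl⟩⟩, inferInstance⟩

theorem eq_root_of_isPeriodicPt {r v : Fin (n + 1)} {s : Fin (n + 1) → Fin (n + 1)}
    (hr : s r = r) (h : ∃ k, s^[k] v = r) {m : ℕ} (hm : 0 < m) (hp : IsPeriodicPt s m v) :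
    v = r := by
  obtain ⟨k, hk⟩ := h
  have h1 : s^[k * m] v = v := hp.const_mul k
  obtain ⟨j, hj⟩ := Nat.exists_eq_add_of_le' (Nat.le_mul_of_pos_right k hm)
  rw [hj, iterate_add_apply, hk, iterate_fixed hr] at h1
  exact h1.symm

/-- Redirecting `x` to a sibling `v` preserves reachability. -/
theorem reaches_update {s : Fin (n + 1) → Fin (n + 1)} {x v : Fin (n + 1)} (hxv : x ≠ v)
    (hs : s x = s v) (w : Fin (n + 1)) (k : ℕ) (z : Fin (n + 1)) (h : s^[k] z = w) :
    ∃ j, (update s x v)^[j] z = w := by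
  induction k generalizing z with
  | zero => exact ⟨0, h⟩
  | succ k ih =>
    obtain ⟨j, hj⟩ := ih (s z) h
    by_cases hz : z = x
    · subst hz
      refine ⟨j + 2, ?_⟩
      rw [iterate_succ_apply, iterate_succ_apply, update_self, update_of_ne hxv.symm, ← hs, hj]
    · exact ⟨j + 1, by rw [iterate_succ_apply, update_of_ne hz, hj]⟩

theorem subtreeSize_le_update {s : Fin (n + 1) → Fin (n + 1)} {x v : Fin (n + 1)} (hxv : x ≠ v)
    (hs : s x = s v) (w : Fin (n + 1)) :
    subtreeSize s w ≤ subtreeSize (update s x v) w :=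
  Nat.card_mono (Set.toFinite _) fun z ⟨k, hk⟩ => reaches_update hxv hs w k z hk

theorem subtreeSize_add_one_le_update {s : Fin (n + 1) → Fin (n + 1)} {x v : Fin (n + 1)}
    (hxv : x ≠ v) (hs : s x = s v) (hvx : ∀ k, s^[k] v ≠ x) :
    subtreeSize s x + 1 ≤ subtreeSize (update s x v) v := by
  have hv : v ∉ {w | ∃ k, s^[k] w = x} := fun ⟨k, hk⟩ => hvx k hk
  unfold subtreeSize
  rw [Nat.card_coe_set_eq, Nat.card_coe_set_eq, ← Set.ncard_insert_of_notMem hv]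
  refine Set.ncard_le_ncard (Set.insert_subset ⟨0, rfl⟩ ?_)
  rintro z ⟨k, hk⟩
  obtain ⟨j, hj⟩ := reaches_update hxv hs x k z hk
  exact ⟨j + 1, by rw [iterate_succ_apply', hj, update_self]⟩

theorem indeg_update_le (r : Fin (n + 1)) (s : Fin (n + 1) → Fin (n + 1)) (x : Fin (n + 1))
    {v w : Fin (n + 1)} (hw : w ≠ v) : indeg r (update s x v) w ≤ indeg r s w := by
  refine Nat.card_mono (Set.toFinite _) fun z ⟨hz, hzw⟩ => ⟨hz, ?_⟩
  by_cases hzx : z = x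
  · subst hzx
    rw [update_self] at hzw
    exact absurd hzw.symm hw
  · rwa [update_of_ne hzx] at hzw

theorem indeg_update_add_one_le {r : Fin (n + 1)} {s : Fin (n + 1) → Fin (n + 1)}
    {x v : Fin (n + 1)} (hx : x ≠ r) (hv : v ≠ s x) :
    indeg r (update s x v) (s x) + 1 ≤ indeg r s (s x) := by
  have hmem : x ∉ {u | u ≠ r ∧ update s x v u = s x} := by
    rintro ⟨-, h⟩
    rw [update_self] at h
    exact hv h
  unfold indeg
  rw [Nat.card_coe_set_eq, Nat.card_coe_set_eq, ← Set.ncard_insert_of_notMem hmem]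
  refine Set.ncard_le_ncard (Set.insert_subset ⟨hx, rfl⟩ fun z hz => ⟨hz.1, ?_⟩)
  have hzx : z ≠ x := fun h => hmem (h ▸ hz)
  rw [← hz.2, update_of_ne hzx]

theorem apply_ne_of_indeg_eq_zero {r v w : Fin (n + 1)} {s : Fin (n + 1) → Fin (n + 1)}
    (hleaf : indeg r s v = 0) (hw : w ≠ r) : s w ≠ v := by
  intro h
  rw [indeg, Nat.card_coe_set_eq, Set.ncard_eq_zero] at hleaf
  exact Set.notMem_empty w (hleaf ▸ ⟨hw, h⟩)

theorem indeg_update_leaf_le_one {r v : Fin (n + 1)} {s : Fin (n + 1) → Fin (n + 1)}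
    (hleaf : indeg r s v = 0) (x : Fin (n + 1)) : indeg r (update s x v) v ≤ 1 := by
  unfold indeg
  rw [Nat.card_coe_set_eq]
  refine le_of_le_of_eq (Set.ncard_le_ncard ?_) (Set.ncard_singleton x)
  rintro z ⟨hz, hzv⟩
  by_contra hzx
  rw [update_of_ne hzx] at hzv
  exact apply_ne_of_indeg_eq_zero hleaf hz hzv

theorem cost_update_le {r : Fin (n + 1)} {s : Fin (n + 1) → Fin (n + 1)} {x v : Fin (n + 1)}
    (hxv : x ≠ v) (hs : s x = s v) (hleaf : indeg r s v = 0) (k : ℕ) (w : Fin (n + 1))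
    (hk : s^[k] w = r) (hw : ∀ j, s^[j] w ≠ x) :
    cost r (update s x v) w ≤ cost r s w := by
  induction k generalizing w with
  | zero =>
    obtain rfl : w = r := hk
    simp only [cost_root, le_refl]
  | succ k ih =>
    by_cases hwr : w = r
    · subst hwr
      simp only [cost_root, le_refl]
    · rw [cost_eq_add_cost _ hwr, cost_eq_add_cost _ hwr, update_of_ne (show w ≠ x from hw 0)]
      refine add_le_add (ENNReal.div_le_div ?_ ?_) (ih (s w) hk fun j => hw (j + 1))
      · exact_mod_cast indeg_update_le r s x (apply_ne_of_indeg_eq_zero hleaf hwr)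
      · exact_mod_cast subtreeSize_le_update hxv hs w

theorem add_one_div_natCast_gt {d m : ℕ} (hd : 0 < d) (hm : 0 < m) :
    (1 : ℝ≥0∞) / m + (d : ℝ≥0∞) / (m + 1 : ℕ) < (d + 1 : ℕ) / m := by
  have hm0 : (m : ℝ≥0∞) ≠ 0 := by exact_mod_cast hm.ne'
  have h1 : (1 : ℝ≥0∞) / m ≠ ⊤ := ENNReal.div_ne_top ENNReal.one_ne_top hm0
  rw [Nat.cast_add d, Nat.cast_one, ENNReal.add_div, add_comm ((d : ℝ≥0∞) / m)]
  refine ENNReal.add_lt_add_left h1 ?_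
  rw [ENNReal.div_eq_inv_mul, ENNReal.div_eq_inv_mul]
  refine ENNReal.mul_lt_mul_left (by exact_mod_cast hd.ne') (ENNReal.natCast_ne_top d) ?_
  exact ENNReal.inv_lt_inv.2 (by exact_mod_cast Nat.lt_succ_self m)

/-- In any stable tree, the parent of any leaf has in-degree exactly `1`:
if `v` is a node with `indeg(v) = 0` and `(v, s v)` is the edge activated by the agent
at `v`, then `indeg(s v) = 1`. -/
theorem parent_of_leaf_has_indegree_one {n : ℕ} (s : Fin (n + 1) → Fin (n + 1))
    (hstable : IsStable 0 s) (htree : ∀ v, ∃ k, s^[k] v = 0)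
    (v : Fin (n + 1)) (hv : v ≠ 0) (hleaf : indeg 0 s v = 0) :
    indeg 0 s (s v) = 1 := by
  obtain ⟨⟨hroot, hvalid⟩, hstab⟩ := hstable
  have hpos : 0 < indeg 0 s (s v) := Nat.card_pos_iff.2 ⟨⟨⟨v, hv, rfl⟩⟩, inferInstance⟩
  by_contra hne
  have hcard : 1 < {u | u ≠ 0 ∧ s u = s v}.ncard := by
    rw [← Nat.card_coe_set_eq]
    change 1 < indeg 0 s (s v)
    omega
  obtain ⟨x, ⟨hx0, hs⟩, hxv⟩ := Set.exists_ne_of_one_lt_ncard hcard v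
  have hux : ∀ k, s^[k] (s v) ≠ x := fun k hk =>
    hx0 (eq_root_of_isPeriodicPt hroot (htree x) k.succ_pos
      (by rw [IsPeriodicPt, IsFixedPt, iterate_succ_apply, hs, hk]))
  have hvx : ∀ k, s^[k] v ≠ x
    | 0 => hxv.symm
    | k + 1 => hux k
  obtain ⟨k, hk⟩ := htree (s v)
  have hdev : cost 0 (update s x v) x ≤
      1 / subtreeSize s x + (indeg 0 s (s v) - 1 : ℕ) / (subtreeSize s x + 1 : ℕ)
        + cost 0 s (s v) := by
    rw [cost_eq_add_cost _ hx0, update_self, cost_eq_add_cost _ hv, update_of_ne hxv.symm,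
      ← add_assoc]
    refine add_le_add (add_le_add (ENNReal.div_le_div ?_ ?_) (ENNReal.div_le_div ?_ ?_))
      (cost_update_le hxv hs hleaf k _ hk hux)
    · exact_mod_cast indeg_update_leaf_le_one hleaf x
    · exact_mod_cast subtreeSize_le_update hxv hs x
    · have h := indeg_update_add_one_le (s := s) hx0 (hs ▸ (hvalid v hv).symm)
      rw [hs] at h
      exact_mod_cast Nat.le_sub_one_of_lt h
    · exact_mod_cast subtreeSize_add_one_le_update hxv hs hvx
  have hle := (hstab x hx0 v hxv.symm).trans hdev
  rw [cost_eq_add_cost s hx0, hs, ENNReal.add_le_add_iff_right (cost_ne_top ⟨k, hk⟩)] at hle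
  refine hle.not_gt ?_
  have h := add_one_div_natCast_gt (d := indeg 0 s (s v) - 1) (by omega) (subtreeSize_pos s x)
  rwa [Nat.sub_add_cancel hpos] at h

end TCG
end
end
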